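/- arXiv:math/0608212 — 4 statements merged into one kernel-verified Lean document; each statement's English description precedes it below -/
import Mathlib

section
/- Let G be a hyperbolic group and let H ⊆ G be a quasiconvex subgroup with [G : H] = ∞. Then there exists a set-theoretic section s : G/H → G of the quotient map G → G/H (i.e., s(gH) ∈ gH for every coset gH) such that s(G/H) is a net in G, i.e., sup_{g ∈ G} d(g, s(G/H)) < ∞ with respect to the word metric. -/
section Preamble

variable {G : Type*} [Group G]

/-- The word length of `g : G` with respect to the generating set `S`. -/
noncomputable def wordLength (S : Set G) (g : G) : ℕ :=
  sInf {n | ∃ w : List G, (∀ x ∈ w, x ∈ S) ∧ w.length = n ∧ w.prod = g}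

/-- The word metric `d(x, y) = |x⁻¹ y|` on the Cayley graph of `G`. -/
noncomputable def wordDist (S : Set G) (x y : G) : ℕ := wordLength S (x⁻¹ * y)

/-- `S` is a finite generating set of `G` closed under inversion. -/
def IsGenSet (S : Set G) : Prop :=
  S.Finite ∧ (∀ x ∈ S, x⁻¹ ∈ S) ∧ Subgroup.closure S = ⊤

/-- `γ`, restricted to `{0, …, n}`, is a geodesic segment in the Cayley graph. -/
def IsGeodesicSegment (S : Set G) (γ : ℕ → G) (n : ℕ) : Prop :=
  ∀ i j, i ≤ n → j ≤ n → wordDist S (γ i) (γ j) = Nat.dist i j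

/-- `r : ℕ → G` is a geodesic ray in the Cayley graph. -/
def IsGeodesicRay (S : Set G) (r : ℕ → G) : Prop :=
  ∀ i j, wordDist S (r i) (r j) = Nat.dist i j

/-- Every geodesic triangle in the Cayley graph of `G` is `δ`-thin: each side lies in
the `δ`-neighborhood of the union of the other two sides. -/
def IsDeltaHyperbolic (S : Set G) (δ : ℕ) : Prop :=
  ∀ (γ₁ γ₂ γ₃ : ℕ → G) (n₁ n₂ n₃ : ℕ),
    IsGeodesicSegment S γ₁ n₁ → IsGeodesicSegment S γ₂ n₂ → IsGeodesicSegment S γ₃ n₃ →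
    γ₁ 0 = γ₃ 0 → γ₁ n₁ = γ₂ 0 → γ₂ n₂ = γ₃ n₃ →
    ∀ k ≤ n₃, ∃ i, (i ≤ n₁ ∧ wordDist S (γ₃ k) (γ₁ i) ≤ δ) ∨
      (i ≤ n₂ ∧ wordDist S (γ₃ k) (γ₂ i) ≤ δ)

/-- `G` is hyperbolic with respect to `S`: some `δ` makes all triangles `δ`-thin. -/
def IsHyperbolic (S : Set G) : Prop := ∃ δ : ℕ, IsDeltaHyperbolic S δ

/-- `H` is a `K`-quasiconvex subgroup: every geodesic between points of `H`
lies in the `K`-neighborhood of `H`. -/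
def IsQuasiconvex (S : Set G) (H : Subgroup G) (K : ℕ) : Prop :=
  ∀ (γ : ℕ → G) (n : ℕ), IsGeodesicSegment S γ n → γ 0 ∈ H → γ n ∈ H →
    ∀ i ≤ n, ∃ h ∈ H, wordDist S (γ i) h ≤ K

/-- Property (*): there is a set-theoretic section `s : G/H → G` of the coset
projection whose image is a net in `G` for the word metric of `S`. -/
def SatisfiesStar (S : Set G) (H : Subgroup G) : Prop :=
  ∃ s : G ⧸ H → G, (∀ q : G ⧸ H, (QuotientGroup.mk (s q) : G ⧸ H) = q) ∧
    ∃ C : ℕ, ∀ g : G, ∃ q : G ⧸ H, wordDist S g (s q) ≤ C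

/-- A hyperbolic group is elementary if it is finite or has an infinite cyclic
subgroup of finite index. -/
def IsElementary (G : Type*) [Group G] : Prop :=
  Finite G ∨ ∃ H : Subgroup G, IsCyclic H ∧ Infinite H ∧ H.index ≠ 0

end Preamble

section Helpers

variable {G : Type*} [Group G]

theorem hx_exists_word {S : Set G} (hGen : IsGenSet S) (g : G) :
    ∃ w : List G, (∀ x ∈ w, x ∈ S) ∧ w.length = wordLength S g ∧ w.prod = g := by
  have hne : {n | ∃ w : List G, (∀ x ∈ w, x ∈ S) ∧ w.length = n ∧ w.prod = g}.Nonempty := by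
    have hg : g ∈ Subgroup.closure S := by rw [hGen.2.2]; trivial
    rw [← Subgroup.mem_toSubmonoid, Subgroup.closure_toSubmonoid] at hg
    obtain ⟨l, hl, hp⟩ := Submonoid.exists_list_of_mem_closure hg
    refine ⟨l.length, l, fun x hx => ?_, rfl, hp⟩
    rcases hl x hx with h | h
    · exact h
    · simpa using hGen.2.1 _ (Set.mem_inv.1 h)
  exact Nat.sInf_mem hne

theorem hx_length_le {S : Set G} (w : List G) (hw : ∀ x ∈ w, x ∈ S) :
    wordLength S w.prod ≤ w.length :=
  Nat.sInf_le ⟨w, hw, rfl, rfl⟩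

theorem hx_length_mul {S : Set G} (hGen : IsGenSet S) (a b : G) :
    wordLength S (a * b) ≤ wordLength S a + wordLength S b := by
  obtain ⟨v, hv, hvl, hvp⟩ := hx_exists_word hGen a
  obtain ⟨w, hw, hwl, hwp⟩ := hx_exists_word hGen b
  have := hx_length_le (S := S) (v ++ w) (by
    intro x hx
    rcases List.mem_append.1 hx with h | h
    · exact hv x h
    · exact hw x h)
  rw [List.prod_append, hvp, hwp, List.length_append, hvl, hwl] at this
  exact this

theorem hx_length_inv_le {S : Set G} (hGen : IsGenSet S) (a : G) :
    wordLength S a⁻¹ ≤ wordLength S a := by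
  obtain ⟨v, hv, hvl, hvp⟩ := hx_exists_word hGen a
  have := hx_length_le (S := S) ((v.map fun x => x⁻¹).reverse) (by
    intro x hx
    simp only [List.mem_reverse, List.mem_map] at hx
    obtain ⟨y, hy, rfl⟩ := hx
    exact hGen.2.1 _ (hv y hy))
  rw [← List.prod_inv_reverse, hvp] at this
  simpa [hvl] using this

theorem hx_comm {S : Set G} (hGen : IsGenSet S) (a b : G) :
    wordDist S a b = wordDist S b a := by
  unfold wordDist
  apply le_antisymm
  · simpa using hx_length_inv_le hGen (b⁻¹ * a)
  · simpa using hx_length_inv_le hGen (a⁻¹ * b)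

theorem hx_tri {S : Set G} (hGen : IsGenSet S) (a b c : G) :
    wordDist S a c ≤ wordDist S a b + wordDist S b c := by
  have := hx_length_mul hGen (a⁻¹ * b) (b⁻¹ * c)
  simpa [wordDist, mul_assoc] using this

theorem hx_left (S : Set G) (g a b : G) : wordDist S (g * a) (g * b) = wordDist S a b := by
  simp [wordDist, mul_assoc]

/-- `p` lies on a geodesic from `x` to `y`. -/
def hxBtw (S : Set G) (x p y : G) : Prop :=
  wordDist S x p + wordDist S p y = wordDist S x y

theorem hx_path {S : Set G} (w : List G) (hw : ∀ x ∈ w, x ∈ S) (x : G) (i j : ℕ)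
    (hij : i ≤ j) : wordDist S (x * (w.take i).prod) (x * (w.take j).prod) ≤ j - i := by
  rw [hx_left]
  obtain ⟨k, rfl⟩ := Nat.exists_eq_add_of_le hij
  unfold wordDist
  rw [List.take_add, List.prod_append, inv_mul_cancel_left]
  refine (hx_length_le _ fun y hy => hw y ?_).trans ?_
  · exact List.mem_of_mem_drop (List.mem_of_mem_take hy)
  · simp

theorem hx_geod {S : Set G} (hGen : IsGenSet S) (w : List G) (hw : ∀ x ∈ w, x ∈ S) (x : G)
    (hmin : wordLength S w.prod = w.length) :
    IsGeodesicSegment S (fun i => x * (w.take i).prod) w.length := by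
  have key : ∀ i j, i ≤ j → j ≤ w.length →
      wordDist S (x * (w.take i).prod) (x * (w.take j).prod) = j - i := by
    intro i j hij hj
    have h1 := hx_path w hw x i j hij
    have h2 := hx_path w hw x 0 i (Nat.zero_le _)
    have h3 := hx_path w hw x j w.length hj
    have h4 : wordDist S (x * (w.take 0).prod) (x * (w.take w.length).prod) = w.length := by
      rw [hx_left]; simpa [wordDist] using hmin
    have h5 := hx_tri hGen (x * (w.take 0).prod) (x * (w.take i).prod)
      (x * (w.take w.length).prod)
    have h6 := hx_tri hGen (x * (w.take i).prod) (x * (w.take j).prod)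
      (x * (w.take w.length).prod)
    omega
  intro i j hi hj
  rcases le_total i j with h | h
  · rw [key i j h hj, Nat.dist_eq_sub_of_le h]
  · rw [hx_comm hGen, key j i h hi, Nat.dist_comm, Nat.dist_eq_sub_of_le h]

/-- A geodesic through a point in between. -/
theorem hx_geod_through {S : Set G} (hGen : IsGenSet S) {x p y : G} (h : hxBtw S x p y) :
    ∃ (γ : ℕ → G) (n k : ℕ), IsGeodesicSegment S γ n ∧ γ 0 = x ∧ γ n = y ∧ k ≤ n ∧ γ k = p := by
  obtain ⟨v, hv, hvl, hvp⟩ := hx_exists_word hGen (x⁻¹ * p)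
  obtain ⟨w, hw, hwl, hwp⟩ := hx_exists_word hGen (p⁻¹ * y)
  refine ⟨fun i => x * ((v ++ w).take i).prod, (v ++ w).length, v.length,
    hx_geod hGen _ ?_ x ?_, ?_, ?_, ?_, ?_⟩
  · intro z hz
    rcases List.mem_append.1 hz with h | h
    · exact hv z h
    · exact hw z h
  · rw [List.prod_append, hvp, hwp, List.length_append, hvl, hwl]
    unfold hxBtw wordDist at h
    rw [h]
    congr 1
    group
  · simp
  · simp only [List.take_length]
    rw [List.prod_append, hvp, hwp]
    group
  · simp
  · simp [hvp]

theorem hx_self (S : Set G) (x : G) : wordDist S x x = 0 := by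
  have := hx_length_le (S := S) ([] : List G) (by simp)
  simpa [wordDist] using this

theorem hx_btw_left (S : Set G) (x y : G) : hxBtw S x x y := by
  simp [hxBtw, hx_self]

theorem hx_btw_symm {S : Set G} (hGen : IsGenSet S) {x p y : G} (h : hxBtw S x p y) :
    hxBtw S y p x := by
  unfold hxBtw at *
  rw [hx_comm hGen y p, hx_comm hGen p x, hx_comm hGen y x]
  omega

theorem hx_geod_btw {S : Set G} {γ : ℕ → G} {n : ℕ} (h : IsGeodesicSegment S γ n) {i : ℕ}
    (hi : i ≤ n) : hxBtw S (γ 0) (γ i) (γ n) := by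
  unfold hxBtw
  rw [h 0 i (Nat.zero_le _) hi, h i n hi le_rfl, h 0 n (Nat.zero_le _) le_rfl]
  rw [Nat.dist_eq_sub_of_le hi, Nat.dist_eq_sub_of_le (Nat.zero_le _),
    Nat.dist_eq_sub_of_le (Nat.zero_le _)]
  omega

theorem hx_exists_btw {S : Set G} (hGen : IsGenSet S) (x y : G) (m : ℕ)
    (hm : m ≤ wordDist S x y) : ∃ p, hxBtw S x p y ∧ wordDist S x p = m := by
  obtain ⟨γ, n, -, hg, h0, hn, -, -⟩ := hx_geod_through hGen (hx_btw_left S x y)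
  have hl : n = wordDist S x y := by
    rw [← h0, ← hn, hg 0 n (Nat.zero_le _) le_rfl, Nat.dist_eq_sub_of_le (Nat.zero_le _)]
    omega
  refine ⟨γ m, ?_, ?_⟩
  · have := hx_geod_btw hg (i := m) (by omega)
    rwa [h0, hn] at this
  · rw [← h0, hg 0 m (Nat.zero_le _) (by omega), Nat.dist_eq_sub_of_le (Nat.zero_le _)]
    omega

theorem hx_thin {S : Set G} (hGen : IsGenSet S) {δ : ℕ} (hδ : IsDeltaHyperbolic S δ)
    {x y z p : G} (h : hxBtw S x p z) :
    ∃ q, (hxBtw S x q y ∨ hxBtw S y q z) ∧ wordDist S p q ≤ δ := by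
  obtain ⟨γ₃, n₃, k, hg₃, h₃0, h₃n, hk, hp⟩ := hx_geod_through hGen h
  obtain ⟨γ₁, n₁, -, hg₁, h₁0, h₁n, -, -⟩ := hx_geod_through hGen (hx_btw_left S x y)
  obtain ⟨γ₂, n₂, -, hg₂, h₂0, h₂n, -, -⟩ := hx_geod_through hGen (hx_btw_left S y z)
  obtain ⟨i, hi | hi⟩ := hδ γ₁ γ₂ γ₃ n₁ n₂ n₃ hg₁ hg₂ hg₃ (by rw [h₁0, h₃0])
    (by rw [h₁n, h₂0]) (by rw [h₂n, h₃n]) k hk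
  · refine ⟨γ₁ i, Or.inl ?_, by rw [← hp]; exact hi.2⟩
    have := hx_geod_btw hg₁ hi.1
    rwa [h₁0, h₁n] at this
  · refine ⟨γ₂ i, Or.inr ?_, by rw [← hp]; exact hi.2⟩
    have := hx_geod_btw hg₂ hi.1
    rwa [h₂0, h₂n] at this

theorem hx_qc {S : Set G} (hGen : IsGenSet S) {H : Subgroup G} {K : ℕ}
    (hK : IsQuasiconvex S H K) {u v p : G} (huv : u⁻¹ * v ∈ H) (h : hxBtw S u p v) :
    ∃ c, u⁻¹ * c ∈ H ∧ wordDist S p c ≤ K := by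
  obtain ⟨γ, n, k, hg, h0, hn, hk, hp⟩ := hx_geod_through hGen h
  obtain ⟨c, hc, hd⟩ := hK (fun i => u⁻¹ * γ i) n
    (by intro i j hi hj; rw [hx_left]; exact hg i j hi hj) (by simp [h0, H.one_mem])
    (by simpa [hn] using huv) k hk
  refine ⟨u * c, by simpa using hc, ?_⟩
  rw [← hx_left S u⁻¹, ← hp]
  simpa using hd

theorem hx_ball_finite {S : Set G} (hGen : IsGenSet S) (n : ℕ) :
    {g : G | wordLength S g ≤ n}.Finite := by
  have hfin : Finite S := hGen.1
  refine ((List.finite_length_le S n).image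
    (fun l : List S => (l.map Subtype.val).prod)).subset ?_
  intro g hg
  obtain ⟨w, hw, hwl, hwp⟩ := hx_exists_word hGen g
  refine ⟨w.attach.map fun x => ⟨x.1, hw x.1 x.2⟩, ?_, ?_⟩
  · simp only [Set.mem_ofPred_eq] at hg ⊢
    simp; omega
  · simp only [List.map_map, Function.comp_def]
    simpa using hwp

/-- If `s` is shortest in its coset and `u` is nearly shortest, then they are close. -/
theorem hx_close {S : Set G} (hGen : IsGenSet S) {δ : ℕ} (hδ : IsDeltaHyperbolic S δ)
    {H : Subgroup G} {K : ℕ} (hK : IsQuasiconvex S H K) {u s : G} (hus : u⁻¹ * s ∈ H)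
    (hmin : ∀ c, u⁻¹ * c ∈ H → wordDist S 1 s ≤ wordDist S 1 c) {C : ℕ}
    (hC : wordDist S 1 u ≤ wordDist S 1 s + C) :
    wordDist S u s ≤ C + 2 * K + 4 * δ + 1 := by
  by_contra hcon
  obtain ⟨p, hp, hpd⟩ := hx_exists_btw hGen u s (C + K + 2 * δ + 1) (by omega)
  obtain ⟨c, hc, hpc⟩ := hx_qc hGen hK hus hp
  have h1 := hmin c hc
  have h2 := hx_tri hGen 1 p c
  obtain ⟨q, hq, hpq⟩ := hx_thin hGen hδ (y := 1) hp
  have h3 := hx_tri hGen 1 q p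
  have h4 := hx_comm hGen p q
  unfold hxBtw at hp
  rcases hq with hq | hq
  · have hq := hx_btw_symm hGen hq
    unfold hxBtw at hq
    have h5 := hx_tri hGen p q u
    have h6 := hx_comm hGen p u
    omega
  · unfold hxBtw at hq
    have h5 := hx_tri hGen p q s
    omega

/-- If `u = g t` is far from shortest then the point of `[g,1]` is near the coset. -/
theorem hx_far {S : Set G} (hGen : IsGenSet S) {δ : ℕ} (hδ : IsDeltaHyperbolic S δ)
    {H : Subgroup G} {K : ℕ} (hK : IsQuasiconvex S H K) {g u s y : G} (hus : u⁻¹ * s ∈ H)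
    {R : ℕ} (hR : wordDist S g u ≤ R) (hy : hxBtw S g y 1) (hyd : wordDist S g y = R + δ + 1)
    (hC : wordDist S 1 s + (2 * R + 3 * δ + 1) < wordDist S 1 u) :
    ∃ c, u⁻¹ * c ∈ H ∧ wordDist S y c ≤ K + 2 * δ := by
  obtain ⟨q, hq, hyq⟩ := hx_thin hGen hδ (y := u) hy
  rcases hq with hq | hq
  · unfold hxBtw at hq
    have h1 := hx_tri hGen g q y
    have h2 := hx_comm hGen y q
    omega
  · obtain ⟨r, hr, hqr⟩ := hx_thin hGen hδ (y := s) hq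
    rcases hr with hr | hr
    · obtain ⟨c, hc, hrc⟩ := hx_qc hGen hK hus hr
      refine ⟨c, hc, ?_⟩
      have h1 := hx_tri hGen y q c
      have h2 := hx_tri hGen q r c
      omega
    · have hr := hx_btw_symm hGen hr
      unfold hxBtw at hr hq
      have h1 := hx_tri hGen 1 r q
      have h2 := hx_comm hGen r q
      have h3 := hx_comm hGen q 1
      have h4 := hx_comm hGen u 1
      have h5 := hx_tri hGen u g q
      have h6 := hx_tri hGen g y q
      have h7 := hx_comm hGen u g
      omega

theorem hx_exists_R {S : Set G} {H : Subgroup G} (hInd : H.index = 0) (N : ℕ) :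
    ∃ (F : Finset (G ⧸ H)) (R : ℕ), F.card = N ∧
      ∀ q ∈ F, wordLength S (Quotient.out q) ≤ R := by
  have : Infinite (G ⧸ H) := Subgroup.index_eq_zero_iff_infinite.1 hInd
  obtain ⟨F, hF⟩ := Infinite.exists_subset_card_eq (G ⧸ H) N
  exact ⟨F, F.sup fun q => wordLength S (Quotient.out q), hF,
    fun q hq => Finset.le_sup (f := fun q : G ⧸ H => wordLength S (Quotient.out q)) hq⟩

theorem hx_exists_min (S : Set G) (H : Subgroup G) (q : G ⧸ H) :
    ∃ s : G, (QuotientGroup.mk s : G ⧸ H) = q ∧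
      ∀ c : G, (QuotientGroup.mk c : G ⧸ H) = q → wordDist S 1 s ≤ wordDist S 1 c := by
  have hne : {c : G | (QuotientGroup.mk c : G ⧸ H) = q}.Nonempty := ⟨q.out, by simp⟩
  obtain ⟨s, hs, hm⟩ := exists_minimalFor_of_wellFoundedLT _ (fun c => wordDist S 1 c) hne
  refine ⟨s, hs, fun c hc => ?_⟩
  rcases le_total (wordDist S 1 s) (wordDist S 1 c) with h | h
  · exact h
  · exact hm hc h

end Helpers

/-- If `G` is a hyperbolic group and `H` a quasiconvex subgroup of
infinite index, then there is a set-theoretic section `s : G/H → G` of the coset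
projection whose image is a net in `G`. -/
theorem statement_0 {G : Type*} [Group G] (S : Set G) (hGen : IsGenSet S)
    (hHyp : IsHyperbolic S) (H : Subgroup G) (hQC : ∃ K : ℕ, IsQuasiconvex S H K)
    (hInd : H.index = 0) :
    ∃ s : G ⧸ H → G, (∀ q : G ⧸ H, (QuotientGroup.mk (s q) : G ⧸ H) = q) ∧
      ∃ C : ℕ, ∀ g : G, ∃ q : G ⧸ H, wordDist S g (s q) ≤ C := by
  classical
  obtain ⟨δ, hδ⟩ := hHyp
  obtain ⟨K, hK⟩ := hQC
  choose s hs hmin using hx_exists_min S H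
  refine ⟨s, hs, ?_⟩
  have hB := hx_ball_finite hGen (K + 2 * δ)
  obtain ⟨F, R, hFc, hFR⟩ := hx_exists_R (S := S) hInd (hB.toFinset.card + 1)
  set C := 2 * R + 3 * δ + 1 with hCdef
  refine ⟨R + (C + 2 * K + 4 * δ + 1), fun g => ?_⟩
  by_contra hcon
  push Not at hcon
  have hmem : ∀ u : G, u⁻¹ * s (QuotientGroup.mk u) ∈ H := fun u =>
    QuotientGroup.eq.1 (hs _).symm
  have hfar : ∀ q ∈ F, wordDist S g (g * q.out) ≤ R ∧
      wordDist S 1 (s (QuotientGroup.mk (g * q.out))) + C < wordDist S 1 (g * q.out) := by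
    intro q hq
    have hd : wordDist S g (g * q.out) ≤ R := by
      have := hFR q hq
      simpa [wordDist] using this
    refine ⟨hd, ?_⟩
    by_contra hle
    have h1 := hx_close hGen hδ hK (hmem (g * q.out))
      (fun c hc => hmin _ c (QuotientGroup.eq.2 hc).symm) (C := C) (by omega)
    have h2 := hcon (QuotientGroup.mk (g * q.out))
    have h3 := hx_tri hGen g (g * q.out) (s (QuotientGroup.mk (g * q.out)))
    omega
  have hFne : F.Nonempty := by
    rw [← Finset.card_pos]; omega
  obtain ⟨q₀, hq₀⟩ := hFne
  obtain ⟨y, hy, hyd⟩ := hx_exists_btw hGen g 1 (R + δ + 1) (by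
    obtain ⟨h1, h2⟩ := hfar q₀ hq₀
    have h3 := hx_tri hGen 1 g (g * q₀.out)
    have h4 := hx_comm hGen 1 g
    omega)
  have hsub : F ⊆ hB.toFinset.image fun b => (QuotientGroup.mk (g⁻¹ * (y * b)) : G ⧸ H) := by
    intro q hq
    obtain ⟨h1, h2⟩ := hfar q hq
    obtain ⟨c, hc, hyc⟩ := hx_far hGen hδ hK (hmem (g * q.out)) h1 hy hyd h2
    rw [Finset.mem_image]
    refine ⟨y⁻¹ * c, by simpa [wordDist] using hyc, ?_⟩
    rw [mul_inv_cancel_left]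
    have : (QuotientGroup.mk q.out : G ⧸ H) = QuotientGroup.mk (g⁻¹ * c) := by
      rw [QuotientGroup.eq]
      simpa [mul_assoc] using hc
    rw [← this]
    simp
  have h1 := Finset.card_le_card hsub
  have h2 := Finset.card_image_le (s := hB.toFinset)
    (f := fun b => (QuotientGroup.mk (g⁻¹ * (y * b)) : G ⧸ H))
  omega
end

section
/- Let G be a hyperbolic group and let H ⊆ G be a quasiconvex subgroup with [G : H] = ∞. Then every subgroup of H that is normal in G is finite. -/
section Aux

variable {G : Type*} [Group G] {S : Set G}

theorem wl_exists_word (hG : IsGenSet S) (g : G) :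
    ∃ w : List G, (∀ x ∈ w, x ∈ S) ∧ w.length = wordLength S g ∧ w.prod = g := by
  have hne : {n | ∃ w : List G, (∀ x ∈ w, x ∈ S) ∧ w.length = n ∧ w.prod = g}.Nonempty := by
    have hg : g ∈ Subgroup.closure S := by rw [hG.2.2]; trivial
    rw [← Subgroup.mem_toSubmonoid, Subgroup.closure_toSubmonoid] at hg
    obtain ⟨w, hw, hp⟩ := Submonoid.exists_list_of_mem_closure hg
    refine ⟨w.length, w, fun x hx => ?_, rfl, hp⟩
    rcases hw x hx with h | h
    · exact h
    · simpa using hG.2.1 _ h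
  exact Nat.sInf_mem hne

theorem wl_le (w : List G) (hw : ∀ x ∈ w, x ∈ S) : wordLength S w.prod ≤ w.length :=
  Nat.sInf_le ⟨w, hw, rfl, rfl⟩

theorem wl_mul (hG : IsGenSet S) (a b : G) :
    wordLength S (a * b) ≤ wordLength S a + wordLength S b := by
  obtain ⟨u, hu, hul, hup⟩ := wl_exists_word hG a
  obtain ⟨v, hv, hvl, hvp⟩ := wl_exists_word hG b
  have := wl_le (S := S) (u ++ v) (by
    intro x hx
    rcases List.mem_append.1 hx with h | h
    · exact hu x h
    · exact hv x h)
  rw [List.prod_append, hup, hvp, List.length_append, hul, hvl] at this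
  exact this

theorem wl_inv_le (hG : IsGenSet S) (a : G) : wordLength S a⁻¹ ≤ wordLength S a := by
  obtain ⟨u, hu, hul, hup⟩ := wl_exists_word hG a
  have := wl_le (S := S) (u.map (fun x => x⁻¹)).reverse (by
    intro x hx
    simp only [List.mem_reverse, List.mem_map] at hx
    obtain ⟨y, hy, rfl⟩ := hx
    exact hG.2.1 _ (hu y hy))
  rw [← List.prod_inv_reverse, hup] at this
  simpa [hul] using this

theorem wl_inv (hG : IsGenSet S) (a : G) : wordLength S a⁻¹ = wordLength S a :=
  le_antisymm (wl_inv_le hG a) (by simpa using wl_inv_le hG a⁻¹)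

theorem wd_comm (hG : IsGenSet S) (a b : G) : wordDist S a b = wordDist S b a := by
  unfold wordDist
  rw [← wl_inv hG]; simp

theorem wd_tri (hG : IsGenSet S) (a b c : G) :
    wordDist S a c ≤ wordDist S a b + wordDist S b c := by
  unfold wordDist
  have := wl_mul hG (a⁻¹ * b) (b⁻¹ * c)
  simpa [mul_assoc] using this

theorem wd_left (a b c : G) : wordDist S (a * b) (a * c) = wordDist S b c := by
  unfold wordDist
  simp [mul_assoc]

theorem exists_geod (hG : IsGenSet S) (x y : G) :
    ∃ γ : ℕ → G, IsGeodesicSegment S γ (wordDist S x y) ∧ γ 0 = x ∧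
      γ (wordDist S x y) = y := by
  obtain ⟨w, hw, hl, hp⟩ := wl_exists_word hG (x⁻¹ * y)
  have hl' : w.length = wordDist S x y := hl
  have hend : x * (w.take (wordDist S x y)).prod = y := by
    rw [← hl', List.take_length, hp]; simp
  refine ⟨fun i => x * (w.take i).prod, ?_, by simp, hend⟩
  -- upper bound
  have up : ∀ i j, i ≤ j → wordDist S (x * (w.take i).prod) (x * (w.take j).prod) ≤ j - i := by
    intro i j hij
    rw [wd_left]
    have e : (w.take i).prod⁻¹ * (w.take j).prod = ((w.take j).drop i).prod := by
      have h := List.prod_take_mul_prod_drop (w.take j) i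
      rw [List.take_take, min_eq_left hij] at h
      rw [← h]; simp
    unfold wordDist
    rw [e]
    refine (wl_le _ fun z hz => hw z (List.mem_of_mem_take (List.mem_of_mem_drop hz))).trans ?_
    simp only [List.length_drop, List.length_take]
    omega
  have main : ∀ i j, i ≤ j → j ≤ wordDist S x y →
      wordDist S (x * (w.take i).prod) (x * (w.take j).prod) = j - i := by
    intro i j hij hj
    have h1 := up i j hij
    have h2 := up 0 i (Nat.zero_le _)
    have h3 := up j _ hj
    rw [hend] at h3
    simp only [List.take_zero, List.prod_nil, mul_one] at h2
    have t1 := wd_tri hG x (x * (w.take i).prod) y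
    have t2 := wd_tri hG (x * (w.take i).prod) (x * (w.take j).prod) y
    omega
  intro i j hi hj
  rcases le_total i j with h | h
  · rw [Nat.dist_eq_sub_of_le h]; exact main i j h hj
  · rw [Nat.dist_eq_sub_of_le_right h, wd_comm hG]; exact main j i h hi

theorem ball_finite (hG : IsGenSet S) (n : ℕ) : {g : G | wordLength S g ≤ n}.Finite := by
  induction n with
  | zero =>
    refine (Set.finite_singleton (1 : G)).subset fun g hg => ?_
    obtain ⟨w, _, hl, hp⟩ := wl_exists_word hG g
    have hg' : wordLength S g ≤ 0 := hg
    have : w = [] := List.length_eq_zero_iff.1 (by omega)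
    subst this
    simpa using hp.symm
  | succ n ih =>
    refine ((Set.finite_singleton (1 : G)).union (hG.1.mul ih)).subset fun g hg => ?_
    obtain ⟨w, hw, hl, hp⟩ := wl_exists_word hG g
    have hg' : wordLength S g ≤ n + 1 := hg
    cases w with
    | nil => left; simpa using hp.symm
    | cons a v =>
      right
      refine Set.mem_mul.2 ⟨a, hw a (by simp), v.prod, ?_, by simpa using hp⟩
      have := wl_le (S := S) v (fun x hx => hw x (by simp [hx]))
      simp only [List.length_cons] at hl
      show wordLength S v.prod ≤ n
      omega

/-- A point on a geodesic `[a, y]`, where `a ∈ H` realizes the distance from `y` to `H`,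
is at least as close to `a` as to any other element of `H`. -/
theorem proj_le (hG : IsGenSet S) {H : Subgroup G} {γ : ℕ → G} {n : ℕ}
    (hγ : IsGeodesicSegment S γ n) {a : G} (ha : γ 0 = a)
    (hmin : ∀ p ∈ H, n ≤ wordDist S (γ n) p) {i : ℕ} (hi : i ≤ n) {p : G} (hp : p ∈ H) :
    wordDist S (γ i) a ≤ wordDist S (γ i) p := by
  have h1 := hγ i 0 hi (Nat.zero_le _)
  have h2 := hγ n i le_rfl hi
  rw [ha, Nat.dist_eq_sub_of_le_right (Nat.zero_le _)] at h1
  rw [Nat.dist_eq_sub_of_le_right hi] at h2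
  have := hmin p hp
  have := wd_tri hG (γ n) (γ i) p
  omega

theorem key (hG : IsGenSet S) {δ C : ℕ} (hδ : IsDeltaHyperbolic S δ) {H : Subgroup G}
    (hC : IsQuasiconvex S H C) {g h : G} (hh : h ∈ H)
    (hg : ∀ p ∈ H, wordLength S g ≤ wordDist S g p)
    (hlong : 2 * (4 * δ + C + 1) ≤ wordLength S h) :
    2 * wordLength S g ≤ wordDist S g (h * g) + 4 * δ + 2 * C := by
  have hd1g : wordDist S 1 g = wordLength S g := by simp [wordDist]
  have hd1h : wordDist S 1 h = wordLength S h := by simp [wordDist]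
  have hdh : wordDist S h (h * g) = wordLength S g := by simp [wordDist]
  have hhg : ∀ p ∈ H, wordLength S g ≤ wordDist S (h * g) p := by
    intro p hp
    have := hg (h⁻¹ * p) (H.mul_mem (H.inv_mem hh) hp)
    rwa [← wd_left h, mul_inv_cancel_left] at this
  obtain ⟨α, hα, hα0, hα1⟩ := exists_geod hG 1 h
  obtain ⟨β, hβ, hβ0, hβ1⟩ := exists_geod hG 1 g
  obtain ⟨ε, hε, hε0, hε1⟩ := exists_geod hG g (h * g)
  obtain ⟨ζ, hζ, hζ0, hζ1⟩ := exists_geod hG h (h * g)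
  obtain ⟨η, hη, hη0, hη1⟩ := exists_geod hG 1 (h * g)
  obtain ⟨θ, hθ, hθ0, hθ1⟩ := exists_geod hG (h * g) h
  rw [hd1g] at hβ hβ1
  rw [hd1h] at hα hα1
  set j := 4 * δ + C + 1 with hj
  have hjl : j ≤ wordLength S h := by omega
  obtain ⟨p, hp, hmp⟩ := hC α _ hα (by rw [hα0]; exact H.one_mem) (by rw [hα1]; exact hh) j hjl
  have hm0 : wordDist S (α j) 1 = j := by
    have := hα j 0 hjl (Nat.zero_le _)
    rwa [hα0, Nat.dist_eq_sub_of_le_right (Nat.zero_le _)] at this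
  have hm1 : j ≤ wordDist S (α j) h := by
    have := hα j _ hjl le_rfl
    rw [hα1, Nat.dist_eq_sub_of_le hjl] at this
    omega
  -- first triangle
  obtain ⟨i, ⟨hi, hd⟩ | ⟨hi, hd⟩⟩ :=
    hδ η θ α _ _ _ hη hθ hα (by rw [hη0, hα0]) (by rw [hη1, hθ0]) (by rw [hθ1, hα1]) j hjl
  · obtain ⟨l, ⟨hl, hd'⟩ | ⟨hl, hd'⟩⟩ :=
      hδ β ε η _ _ _ hβ hε hη (by rw [hη0, hβ0]) (by rw [hβ1, hε0]) (by rw [hε1, hη1]) i hi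
    · exfalso
      have a1 := proj_le hG hβ hβ0 (by rw [hβ1]; exact hg) hl hp
      have a2 := wd_tri hG (α j) (η i) (β l)
      have a3 := wd_tri hG (α j) (β l) 1
      have a4 := wd_tri hG (β l) (α j) p
      rw [wd_comm hG (β l) (α j)] at a4
      omega
    · have a2 := wd_tri hG (α j) (η i) (ε l)
      have a4 := wd_tri hG (ε l) (α j) p
      rw [wd_comm hG (ε l) (α j)] at a4
      have b1 := hε 0 l (Nat.zero_le _) hl
      have b2 := hε _ l le_rfl hl
      rw [hε0, Nat.dist_eq_sub_of_le (Nat.zero_le _)] at b1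
      rw [hε1, Nat.dist_eq_sub_of_le_right hl] at b2
      have c1 := hg p hp
      have c2 := hhg p hp
      have c3 := wd_tri hG g (ε l) p
      have c4 := wd_tri hG (h * g) (ε l) p
      omega
  · exfalso
    have b1 := hθ i 0 hi (Nat.zero_le _)
    have b2 := hθ i _ hi le_rfl
    rw [hθ0, Nat.dist_eq_sub_of_le_right (Nat.zero_le _)] at b1
    rw [hθ1, Nat.dist_eq_sub_of_le hi] at b2
    rw [wd_comm hG (h * g) h, hdh] at b2 hi
    have a1 := hhg p hp
    have a2 := wd_tri hG (h * g) (θ i) p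
    rw [wd_comm hG (h * g) (θ i)] at a2
    have a3 := wd_tri hG (α j) (θ i) h
    have a4 := wd_tri hG (θ i) (α j) p
    rw [wd_comm hG (θ i) (α j)] at a4
    omega

/-- Infinite index gives elements arbitrarily far from `H` whose nearest point in `H` is `1`. -/
theorem exists_far (hG : IsGenSet S) {H : Subgroup G} (hInd : H.index = 0) (n : ℕ) :
    ∃ g : G, n ≤ wordLength S g ∧ ∀ p ∈ H, wordLength S g ≤ wordDist S g p := by
  by_contra hcon
  push Not at hcon
  have hfin : Finite (G ⧸ H) := by
    have hB := ball_finite hG n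
    refine Set.finite_univ_iff.1 ((hB.image (fun g => (QuotientGroup.mk g : G ⧸ H))).subset ?_)
    intro q _
    induction q using QuotientGroup.induction_on with
    | H a =>
    -- choose the shortest element of the coset `aH`
    let T : Set ℕ := {m | ∃ p ∈ H, wordLength S (a * p) = m}
    have hT : T.Nonempty := ⟨_, 1, H.one_mem, rfl⟩
    obtain ⟨p, hp, hpm⟩ := Nat.sInf_mem hT
    refine ⟨a * p, ?_, ?_⟩
    · show wordLength S (a * p) ≤ n
      by_contra hlt
      obtain ⟨r, hr, hrl⟩ := hcon (a * p)⁻¹ (by rw [wl_inv hG]; omega)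
      rw [wl_inv hG] at hrl
      have : sInf T ≤ wordLength S (a * (p * r)) := Nat.sInf_le ⟨p * r, H.mul_mem hp hr, rfl⟩
      unfold wordDist at hrl
      rw [inv_inv, mul_assoc] at hrl
      omega
    · simp [hp]
  exact H.index_ne_zero_of_finite hInd

end Aux

/-- Every subgroup of a quasiconvex subgroup of infinite index that is
normal in the ambient hyperbolic group is finite. -/
theorem statement_2 {G : Type*} [Group G] (S : Set G) (hGen : IsGenSet S)
    (hHyp : IsHyperbolic S) (H : Subgroup G) (hQC : ∃ C : ℕ, IsQuasiconvex S H C)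
    (hInd : H.index = 0) (K : Subgroup G) (hKH : K ≤ H) (hKnorm : K.Normal) :
    Finite K := by
  obtain ⟨δ, hδ⟩ := hHyp
  obtain ⟨C, hC⟩ := hQC
  have hB := ball_finite hGen (2 * (4 * δ + C + 1))
  by_contra hinf
  have hKinf : (K : Set G).Infinite := fun h => hinf h.to_subtype
  obtain ⟨F, hFK, hFc⟩ := hKinf.exists_subset_card_eq (hB.toFinset.card + 1)
  obtain ⟨g, hgn, hgmin⟩ := exists_far hGen hInd (F.sup (wordLength S) + 4 * δ + 2 * C + 1)
  have hmaps : ∀ k ∈ F, g * k * g⁻¹ ∈ hB.toFinset := by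
    intro k hk
    rw [Set.Finite.mem_toFinset]
    show wordLength S (g * k * g⁻¹) ≤ _
    by_contra hlt
    have hkK : g * k * g⁻¹ ∈ K := hKnorm.conj_mem k (hFK hk) g
    have h1 := key hGen hδ hC (hKH hkK) hgmin (by omega)
    have h2 : wordDist S g (g * k * g⁻¹ * g) = wordLength S k := by simp [wordDist, mul_assoc]
    have h3 : wordLength S k ≤ F.sup (wordLength S) := Finset.le_sup hk
    omega
  have := Finset.card_le_card_of_injOn (fun k => g * k * g⁻¹) hmaps
    (fun x _ y _ hxy => by simpa using hxy)
  omega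
end

section
/- Let Q be a finitely generated group acting on groups N and N', and suppose the semidirect products E = N ⋊ Q and E' = N' ⋊ Q are finitely generated. Let X = (N × N') ⋊ Q, where Q acts on N × N' diagonally. If the pairs (E, Q) and (E', Q) both satisfy property (*), then the pair (X, Q) also satisfies property (*). -/
/-- The diagonal action of `Q` on `N × N'` induced by actions on `N` and `N'`. -/
def diagAction {N N' Q : Type*} [Group N] [Group N'] [Group Q]
    (φ : Q →* MulAut N) (φ' : Q →* MulAut N') : Q →* MulAut (N × N') :=
  MonoidHom.mk' (fun q => (φ q).prodCongr (φ' q)) (by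
    intro a b
    ext x <;> simp [MulEquiv.prodCongr, MulAut.mul_apply])

section Helpers

theorem mem_word_of_genSet {G : Type*} [Group G] {S : Set G} (hS : IsGenSet S) (g : G) :
    ∃ w : List G, (∀ x ∈ w, x ∈ S) ∧ w.prod = g := by
  have hg : g ∈ Subgroup.closure S := by rw [hS.2.2]; trivial
  obtain ⟨w, hw, hp⟩ := Submonoid.exists_list_of_mem_closure
    (Subgroup.closure_toSubmonoid S ▸ (Subgroup.mem_toSubmonoid _ _).2 hg)
  refine ⟨w, fun x hx => ?_, hp⟩
  rcases hw x hx with h | h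
  · exact h
  · simpa using hS.2.1 _ h

theorem wordLength_map_le {G H : Type*} [Group G] [Group H] {S : Set G} (hS : IsGenSet S)
    (f : G →* H) {T : Set H} (hT : ∀ x ∈ S, f x ∈ T) (g : G) :
    wordLength T (f g) ≤ wordLength S g := by
  have hne : {n | ∃ w : List G, (∀ x ∈ w, x ∈ S) ∧ w.length = n ∧ w.prod = g}.Nonempty := by
    obtain ⟨w, h1, h2⟩ := mem_word_of_genSet hS g
    exact ⟨_, w, h1, rfl, h2⟩
  obtain ⟨w, h1, h2, h3⟩ := Nat.sInf_mem hne
  apply Nat.sInf_le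
  refine ⟨w.map f, ?_, by rw [List.length_map, h2]; rfl, by rw [← map_list_prod, h3]⟩
  intro x hx
  obtain ⟨y, hy, rfl⟩ := List.mem_map.1 hx
  exact hT y (h1 y hy)

theorem mk_eq_iff_left {N Q : Type*} [Group N] [Group Q] {φ : Q →* MulAut N} (a b : N ⋊[φ] Q) :
    (QuotientGroup.mk a : (N ⋊[φ] Q) ⧸ (SemidirectProduct.inr : Q →* N ⋊[φ] Q).range)
      = QuotientGroup.mk b ↔ a.left = b.left := by
  rw [QuotientGroup.eq]
  constructor
  · rintro ⟨q, hq⟩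
    have h : b = a * SemidirectProduct.inr q := by rw [hq]; group
    rw [h]; simp
  · intro h
    refine ⟨a.right⁻¹ * b.right, ?_⟩
    ext <;> simp [h]

variable {N N' Q : Type*} [Group N] [Group N'] [Group Q]
  (φ : Q →* MulAut N) (φ' : Q →* MulAut N')

theorem diagAction_apply (q : Q) (x : N × N') :
    diagAction φ φ' q x = (φ q x.1, φ' q x.2) := rfl

/-- The embedding of `N ⋊ Q`. -/
def emb₁ : N ⋊[φ] Q →* (N × N') ⋊[diagAction φ φ'] Q where
  toFun e := ⟨(e.left, 1), e.right⟩
  map_one' := rfl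
  map_mul' a b := by
    ext <;> simp [diagAction_apply]

/-- The embedding of the second semidirect product. -/
def emb₂ : N' ⋊[φ'] Q →* (N × N') ⋊[diagAction φ φ'] Q where
  toFun e := ⟨(1, e.left), e.right⟩
  map_one' := rfl
  map_mul' a b := by
    ext <;> simp [diagAction_apply]

theorem emb_decomp (n : N) (n' : N') (q : Q) :
    (⟨(n, n'), q⟩ : (N × N') ⋊[diagAction φ φ'] Q) =
      emb₂ φ φ' ⟨n', 1⟩ * emb₁ φ φ' ⟨n, q⟩ := by
  ext <;> simp [diagAction_apply, emb₁, emb₂]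

end Helpers

/-- If `(N ⋊ Q, Q)` and `(N' ⋊ Q, Q)` satisfy property (*), then so
does `((N × N') ⋊ Q, Q)`, where `Q` acts diagonally. -/
theorem statement_13 {N N' Q : Type*} [Group N] [Group N'] [Group Q]
    (hQ : Group.FG Q) (φ : Q →* MulAut N) (φ' : Q →* MulAut N')
    (hE : ∃ S : Set (N ⋊[φ] Q), IsGenSet S ∧
      SatisfiesStar S (SemidirectProduct.inr : Q →* N ⋊[φ] Q).range)
    (hE' : ∃ S' : Set (N' ⋊[φ'] Q), IsGenSet S' ∧
      SatisfiesStar S' (SemidirectProduct.inr : Q →* N' ⋊[φ'] Q).range) :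
    ∃ T : Set ((N × N') ⋊[diagAction φ φ'] Q), IsGenSet T ∧
      SatisfiesStar T (SemidirectProduct.inr : Q →* (N × N') ⋊[diagAction φ φ'] Q).range := by
  obtain ⟨S, hS, s, hs, C, hC⟩ := hE
  obtain ⟨S', hS', -⟩ := hE'
  refine ⟨Set.image (emb₁ φ φ') S ∪ Set.image (emb₂ φ φ') S', ⟨?_, ?_, ?_⟩, ?_⟩
  · exact (hS.1.image _).union (hS'.1.image _)
  · rintro x (⟨y, hy, rfl⟩ | ⟨y, hy, rfl⟩)
    · exact Or.inl ⟨y⁻¹, hS.2.1 y hy, map_inv _ _⟩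
    · exact Or.inr ⟨y⁻¹, hS'.2.1 y hy, map_inv _ _⟩
  · rw [Subgroup.closure_union, ← MonoidHom.map_closure, ← MonoidHom.map_closure,
      hS.2.2, hS'.2.2, eq_top_iff]
    rintro ⟨⟨n, n'⟩, q⟩ -
    rw [emb_decomp]
    exact mul_mem (Subgroup.mem_sup_right ⟨_, trivial, rfl⟩)
      (Subgroup.mem_sup_left ⟨_, trivial, rfl⟩)
  · refine ⟨fun c => ⟨c.out.left,
      (s (QuotientGroup.mk (SemidirectProduct.inl c.out.left.1))).right⟩, ?_, C, ?_⟩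
    · intro c
      conv_rhs => rw [← QuotientGroup.out_eq' c]
      rw [mk_eq_iff_left]
    · rintro ⟨⟨n, n'⟩, q⟩
      obtain ⟨c, hc⟩ := hC ⟨n, q⟩
      refine ⟨QuotientGroup.mk ⟨((s c).left, n'), 1⟩, ?_⟩
      have hout := (mk_eq_iff_left _ _).1 (QuotientGroup.out_eq' (QuotientGroup.mk
        (⟨((s c).left, n'), 1⟩ : (N × N') ⋊[diagAction φ φ'] Q) :
          _ ⧸ (SemidirectProduct.inr : Q →* (N × N') ⋊[diagAction φ φ'] Q).range))
      simp only [hout]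
      have h2 : (QuotientGroup.mk (SemidirectProduct.inl (s c).left) :
          _ ⧸ (SemidirectProduct.inr : Q →* N ⋊[φ] Q).range) = c := by
        conv_rhs => rw [← hs c]
        rw [mk_eq_iff_left]; simp
      rw [h2, emb_decomp, emb_decomp φ φ' (s c).left]
      refine le_trans ?_ hc
      unfold wordDist
      have h3 : (emb₂ φ φ' ⟨n', 1⟩ * emb₁ φ φ' ⟨n, q⟩)⁻¹ *
          (emb₂ φ φ' ⟨n', 1⟩ * emb₁ φ φ' ⟨(s c).left, (s c).right⟩) =
          emb₁ φ φ' (⟨n, q⟩⁻¹ * s c) := by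
        rw [map_mul, map_inv]; group
      rw [h3]
      exact wordLength_map_le hS (emb₁ φ φ') (fun x hx => Or.inl (Set.mem_image_of_mem _ hx)) _
end

section
/- Let G be an infinite hyperbolic group with finite generating set Σ. Then there exists a constant C > 0 such that for every g ∈ G there is a geodesic ray r from 1 in the Cayley graph Γ = C(G,Σ) with d(g, r(t)) ≤ C for some t. -/
namespace RayAux

variable {G : Type*} [Group G] {S : Set G}

lemma exists_word (h : IsGenSet S) (g : G) :
    ∃ w : List G, (∀ x ∈ w, x ∈ S) ∧ w.length = wordLength S g ∧ w.prod = g := by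
  have hne : {n | ∃ w : List G, (∀ x ∈ w, x ∈ S) ∧ w.length = n ∧ w.prod = g}.Nonempty := by
    have hg : g ∈ Subgroup.closure S := by rw [h.2.2]; trivial
    rw [← Subgroup.mem_toSubmonoid, Subgroup.closure_toSubmonoid] at hg
    obtain ⟨l, hl, hp⟩ := Submonoid.exists_list_of_mem_closure hg
    refine ⟨l.length, l, ?_, rfl, hp⟩
    intro x hx
    rcases hl x hx with h1 | h1
    · exact h1
    · simpa using h.2.1 _ h1
  exact Nat.sInf_mem hne

lemma length_le {w : List G} (hw : ∀ x ∈ w, x ∈ S) : wordLength S w.prod ≤ w.length :=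
  Nat.sInf_le ⟨w, hw, rfl, rfl⟩

lemma length_mul (h : IsGenSet S) (a b : G) :
    wordLength S (a * b) ≤ wordLength S a + wordLength S b := by
  obtain ⟨u, hu, hul, hup⟩ := exists_word h a
  obtain ⟨v, hv, hvl, hvp⟩ := exists_word h b
  have := length_le (S := S) (w := u ++ v) (by
    intro x hx
    rcases List.mem_append.1 hx with h1 | h1
    · exact hu x h1
    · exact hv x h1)
  rw [List.prod_append, hup, hvp, List.length_append] at this
  omega

lemma length_inv_le (h : IsGenSet S) (a : G) : wordLength S a⁻¹ ≤ wordLength S a := by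
  obtain ⟨u, hu, hul, hup⟩ := exists_word h a
  have := length_le (S := S) (w := (u.map (fun x => x⁻¹)).reverse) (by
    intro x hx
    simp only [List.mem_reverse, List.mem_map] at hx
    obtain ⟨y, hy, rfl⟩ := hx
    exact h.2.1 _ (hu y hy))
  rw [← List.prod_inv_reverse, hup, List.length_reverse, List.length_map] at this
  omega

lemma dist_symm (h : IsGenSet S) (x y : G) : wordDist S x y = wordDist S y x := by
  unfold wordDist
  apply le_antisymm
  · simpa using length_inv_le h (y⁻¹ * x)
  · simpa using length_inv_le h (x⁻¹ * y)

lemma dist_tri (h : IsGenSet S) (x y z : G) :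
    wordDist S x z ≤ wordDist S x y + wordDist S y z := by
  unfold wordDist
  have := length_mul h (x⁻¹ * y) (y⁻¹ * z)
  simpa [mul_assoc] using this

lemma dist_mul (a x y : G) : wordDist S (a * x) (a * y) = wordDist S x y := by
  unfold wordDist
  congr 1
  group

lemma ball_finite (h : IsGenSet S) (n : ℕ) : {g : G | wordLength S g ≤ n}.Finite := by
  haveI : Finite S := h.1
  refine ((List.finite_length_le S n).image (fun l => (l.map Subtype.val).prod)).subset ?_
  intro g hg
  obtain ⟨u, hu, hul, hup⟩ := exists_word h g
  refine ⟨u.attach.map (fun x => ⟨x.1, hu x.1 x.2⟩), ?_, ?_⟩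
  · simpa [hul] using hg
  · simp [List.map_map, Function.comp_def, hup]

lemma segment_of_le (h : IsGenSet S) (γ : ℕ → G) (n : ℕ)
    (H : ∀ i j, i ≤ j → j ≤ n → wordDist S (γ i) (γ j) = j - i) : IsGeodesicSegment S γ n := by
  intro i j hi hj
  rcases le_total i j with hij | hij
  · rw [H i j hij hj, Nat.dist_eq_sub_of_le hij]
  · rw [dist_symm h, H j i hij hi, Nat.dist_eq_sub_of_le_right hij]

lemma exists_geodesic (h : IsGenSet S) (x y : G) :
    ∃ γ : ℕ → G, IsGeodesicSegment S γ (wordDist S x y) ∧ γ 0 = x ∧ γ (wordDist S x y) = y := by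
  obtain ⟨w, hw, hl, hp⟩ := exists_word h (x⁻¹ * y)
  change w.length = wordDist S x y at hl
  have h0 : x * (w.take 0).prod = x := by simp
  have h1 : x * (w.take (wordDist S x y)).prod = y := by
    rw [← hl, List.take_length, hp]; group
  have up : ∀ i j, i ≤ j → wordDist S (x * (w.take i).prod) (x * (w.take j).prod) ≤ j - i := by
    intro i j hij
    rw [dist_mul]
    have e : (w.take j).prod = (w.take i).prod * ((w.take j).drop i).prod := by
      rw [← List.prod_append]
      congr 1
      conv_lhs => rw [← List.take_append_drop i (w.take j)]
      rw [List.take_take, min_eq_left hij]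
    unfold wordDist
    rw [e, inv_mul_cancel_left]
    refine (length_le ?_).trans ?_
    · intro z hz
      exact hw z (List.mem_of_mem_take (List.mem_of_mem_drop hz))
    · simp only [List.length_drop, List.length_take]; omega
  refine ⟨fun i => x * (w.take i).prod, ?_, h0, h1⟩
  apply segment_of_le h
  intro i j hij hj
  have a1 := up 0 i (Nat.zero_le _)
  have a2 := up i j hij
  have a3 := up j _ hj
  rw [h0] at a1
  rw [h1] at a3
  have t1 := dist_tri h x (x * (w.take i).prod) y
  have t2 := dist_tri h (x * (w.take i).prod) (x * (w.take j).prod) y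
  show wordDist S (x * (w.take i).prod) (x * (w.take j).prod) = j - i
  omega

lemma segment_mono {γ : ℕ → G} {m n : ℕ} (hmn : m ≤ n) (hγ : IsGeodesicSegment S γ n) :
    IsGeodesicSegment S γ m := fun i j hi hj => hγ i j (hi.trans hmn) (hj.trans hmn)

lemma exists_long (h : IsGenSet S) (hInf : Infinite G) (g : G) (n : ℕ) :
    ∃ γ : ℕ → G, IsGeodesicSegment S γ (2 * n) ∧ γ n = g := by
  obtain ⟨y, hy⟩ := (ball_finite h (2 * n)).exists_notMem
  obtain ⟨γ, hγ, -, -⟩ := exists_geodesic h 1 y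
  have hle : 2 * n ≤ wordDist S 1 y := by
    simp only [Set.mem_setOf_eq, not_le] at hy
    simp only [wordDist, inv_one, one_mul]
    omega
  refine ⟨fun i => (g * (γ n)⁻¹) * γ i, ?_, by simp⟩
  intro i j hi hj
  rw [dist_mul]
  exact segment_mono hle hγ i j hi hj

/-- Arbitrarily long geodesic segments from `1` passing near `g`. -/
lemma exists_near (h : IsGenSet S) (hInf : Infinite G) {δ : ℕ} (hδ : IsDeltaHyperbolic S δ)
    (g : G) (N : ℕ) :
    ∃ (γ : ℕ → G) (m : ℕ), N ≤ m ∧ IsGeodesicSegment S γ m ∧ γ 0 = 1 ∧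
      ∃ t ≤ m, wordDist S g (γ t) ≤ δ := by
  obtain ⟨c, hc, hcg⟩ := exists_long h hInf g (N + wordDist S 1 g)
  set n := N + wordDist S 1 g with hn
  obtain ⟨α, hα, hα0, hα1⟩ := exists_geodesic h 1 (c 0)
  obtain ⟨β, hβ, hβ0, hβ1⟩ := exists_geodesic h 1 (c (2 * n))
  have da : wordDist S g (c 0) = n := by
    rw [← hcg, hc n 0 (by omega) (by omega)]; simp [Nat.dist]
  have db : wordDist S g (c (2 * n)) = n := by
    rw [← hcg, hc n (2 * n) (by omega) (by omega)]; simp [Nat.dist]; omega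
  have ta := dist_tri h g 1 (c 0)
  have tb := dist_tri h g 1 (c (2 * n))
  rw [dist_symm h g 1] at ta tb
  set m := wordDist S 1 (c 0) with hm
  have hrev : IsGeodesicSegment S (fun i => α (m - i)) m := by
    intro i j hi hj
    show wordDist S (α (m - i)) (α (m - j)) = _
    rw [hα (m - i) (m - j) (by omega) (by omega)]
    simp only [Nat.dist]; omega
  obtain ⟨i, ⟨hi, hd⟩ | ⟨hi, hd⟩⟩ := hδ _ β c m _ (2 * n) hrev hβ hc (by simpa using hα1)
    (by simp [hα0, hβ0]) hβ1 n (by omega)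
  · rw [hcg] at hd
    exact ⟨α, m, by omega, hα, hα0, m - i, by omega, hd⟩
  · rw [hcg] at hd
    exact ⟨β, _, by omega, hβ, hβ0, i, hi, hd⟩

lemma isClosed_coord [TopologicalSpace G] [DiscreteTopology G] (i j : ℕ) (P : G → G → Prop) :
    IsClosed {γ : ℕ → G | P (γ i) (γ j)} := by
  have : Continuous (fun γ : ℕ → G => (γ i, γ j)) := by fun_prop
  exact (isClosed_discrete {p : G × G | P p.1 p.2}).preimage this

lemma exists_ray (h : IsGenSet S) (hInf : Infinite G) {δ : ℕ} (hδ : IsDeltaHyperbolic S δ)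
    (g : G) :
    ∃ r : ℕ → G, IsGeodesicRay S r ∧ r 0 = 1 ∧ ∃ t : ℕ, wordDist S g (r t) ≤ δ := by
  letI : TopologicalSpace G := ⊥
  haveI : DiscreteTopology G := ⟨rfl⟩
  set T := wordDist S 1 g + δ with hT
  let B : Set (ℕ → G) := Set.univ.pi fun i => {x : G | wordLength S x ≤ i}
  have hB : IsCompact B := isCompact_univ_pi fun i => (ball_finite h i).isCompact
  let E : Set (ℕ → G) := ⋃ t ∈ Set.Iic T, {γ | wordDist S g (γ t) ≤ δ}
  have hE : IsClosed E := (Set.finite_Iic T).isClosed_biUnion fun t _ =>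
    isClosed_coord t t (fun a _ => wordDist S g a ≤ δ)
  let Z : Set (ℕ → G) := {γ | γ 0 = 1}
  have hZ : IsClosed Z := isClosed_coord 0 0 (fun a _ => a = 1)
  let F : ℕ → Set (ℕ → G) := fun N => {γ | IsGeodesicSegment S γ N}
  have hF : ∀ N, IsClosed (F N) := by
    intro N
    have : F N = ⋂ i, ⋂ j, {γ | i ≤ N → j ≤ N → wordDist S (γ i) (γ j) = Nat.dist i j} := by
      ext γ; simp [F, IsGeodesicSegment]
    rw [this]
    exact isClosed_iInter fun i => isClosed_iInter fun j =>
      isClosed_coord i j (fun a b => i ≤ N → j ≤ N → wordDist S a b = Nat.dist i j)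
  let K : ℕ → Set (ℕ → G) := fun N => B ∩ (E ∩ (Z ∩ F N))
  have hKc : ∀ N, IsClosed (K N) := fun N => by
    refine IsClosed.inter ?_ (hE.inter (hZ.inter (hF N)))
    exact isClosed_set_pi fun i _ => isClosed_discrete _
  have hne : ∀ N, (K N).Nonempty := by
    intro N
    obtain ⟨γ, m, hm, hγ, h0, t, ht, hd⟩ := exists_near h hInf hδ g N
    have hlen : ∀ i ≤ m, wordDist S 1 (γ i) = i := by
      intro i hi
      rw [← h0, hγ 0 i (by omega) hi]; simp [Nat.dist]
    refine ⟨fun i => γ (min i m), ?_, ?_, ?_, ?_⟩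
    · intro i _
      have := hlen (min i m) (min_le_right _ _)
      simp only [wordDist, inv_one, one_mul] at this
      show wordLength S (γ (min i m)) ≤ i
      rw [this]; exact min_le_left _ _
    · have h1 := hlen t ht
      have h2 := dist_tri h 1 g (γ t)
      refine Set.mem_biUnion (x := t) (show t ≤ T by omega) ?_
      show wordDist S g (γ (min t m)) ≤ δ
      rwa [min_eq_left ht]
    · show γ (min 0 m) = 1
      simpa using h0
    · intro i j hi hj
      show wordDist S (γ (min i m)) (γ (min j m)) = _
      rw [min_eq_left (hi.trans hm), min_eq_left (hj.trans hm)]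
      exact hγ i j (hi.trans hm) (hj.trans hm)
  obtain ⟨r, hr⟩ := IsCompact.nonempty_iInter_of_sequence_nonempty_isCompact_isClosed K
    (fun N γ hγ => ⟨hγ.1, hγ.2.1, hγ.2.2.1, segment_mono (Nat.le_succ N) hγ.2.2.2⟩) hne
    (hB.of_isClosed_subset (hKc 0) Set.inter_subset_left) hKc
  have hr' : ∀ N, r ∈ K N := fun N => Set.mem_iInter.1 hr N
  refine ⟨r, ?_, (hr' 0).2.2.1, ?_⟩
  · intro i j
    exact (hr' (max i j)).2.2.2 i j (le_max_left _ _) (le_max_right _ _)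
  · obtain ⟨t, -, ht⟩ := Set.mem_iUnion₂.1 (hr' 0).2.1
    exact ⟨t, ht⟩

end RayAux

/-- (Proposition 3G) In an infinite hyperbolic group there is a
constant `C` such that every element lies within `C` of some geodesic ray from `1`. -/
theorem statement_14 {G : Type*} [Group G] (S : Set G) (hGen : IsGenSet S)
    (hHyp : IsHyperbolic S) (hInf : Infinite G) :
    ∃ C : ℕ, 0 < C ∧ ∀ g : G, ∃ r : ℕ → G, IsGeodesicRay S r ∧ r 0 = 1 ∧
      ∃ t : ℕ, wordDist S g (r t) ≤ C := by
  obtain ⟨δ, hδ⟩ := hHyp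
  refine ⟨δ + 1, Nat.succ_pos _, fun g => ?_⟩
  obtain ⟨r, h1, h2, t, ht⟩ := RayAux.exists_ray hGen hInf hδ g
  exact ⟨r, h1, h2, t, ht.trans (Nat.le_succ _)⟩
end
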